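/- arXiv:math/0407007 — 3 statements merged into one kernel-verified Lean document; each statement's English description precedes it below -/
import Mathlib

section
/- For any board B and any k ≥ 2, the number of placements of k non-attacking rooks on B satisfies r_k(B) ≤ C(r_{k-1}(B), 2), where C(·,·) denotes the binomial coefficient. -/
/-- A board is a finite subset of ℕ × ℕ.  `rookNum B k` is the number of placements of `k`
non-attacking rooks on `B`, i.e. `k`-element subsets of `B` in which no two distinct cells
share a column (first coordinate) or a row (second coordinate). -/
def rookNum (B : Finset (ℕ × ℕ)) (k : ℕ) : ℕ :=
  (B.powerset.filter (fun P => P.card = k ∧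
    ∀ p ∈ P, ∀ q ∈ P, p ≠ q → p.1 ≠ q.1 ∧ p.2 ≠ q.2)).card

/-- If every member of `t` is the union of two distinct members of `s`,
then `t` has at most as many members as there are pairs in `s`. -/
theorem Finset.card_le_choose_two_of_union {α : Type*} [DecidableEq α] (s t : Finset (Finset α))
    (h : ∀ P ∈ t, ∃ Q ∈ s, ∃ R ∈ s, Q ≠ R ∧ Q ∪ R = P) : t.card ≤ s.card.choose 2 := by
  rw [← Finset.card_powersetCard]
  refine Finset.card_le_card_of_surjOn (fun u => u.sup id) fun P hP => ?_
  obtain ⟨Q, hQ, R, hR, hne, rfl⟩ := h P hP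
  refine ⟨{Q, R}, ?_, by simp⟩
  simp [Finset.mem_powersetCard, Finset.insert_subset_iff, hQ, hR, Finset.card_pair hne]

/-- For `k ≥ 2`, `r_k(B) ≤ C(r_{k-1}(B), 2)`. -/
theorem rookNum_le_choose_pred (B : Finset (ℕ × ℕ)) (k : ℕ) (hk : 2 ≤ k) :
    rookNum B k ≤ Nat.choose (rookNum B (k - 1)) 2 := by
  refine Finset.card_le_choose_two_of_union _ _ fun P hP => ?_
  simp only [Finset.mem_filter, Finset.mem_powerset] at hP ⊢
  obtain ⟨hPB, hcard, hrook⟩ := hP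
  obtain ⟨p, hp, q, hq, hpq⟩ := Finset.one_lt_card.mp (show 1 < P.card by omega)
  have herase : ∀ x ∈ P, P.erase x ⊆ B ∧ (P.erase x).card = k - 1 ∧
      ∀ a ∈ P.erase x, ∀ b ∈ P.erase x, a ≠ b → a.1 ≠ b.1 ∧ a.2 ≠ b.2 := fun x hx =>
    ⟨(Finset.erase_subset x P).trans hPB, by rw [Finset.card_erase_of_mem hx, hcard],
      fun a ha b hb => hrook a (Finset.mem_of_mem_erase ha) b (Finset.mem_of_mem_erase hb)⟩
  refine ⟨P.erase p, herase p hp, P.erase q, herase q hq, fun h => ?_, ?_⟩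
  · exact Finset.notMem_erase q P (h ▸ Finset.mem_erase.mpr ⟨hpq.symm, hq⟩)
  · ext x
    simp only [Finset.mem_union, Finset.mem_erase]
    grind
end

section
/- (Factorization Theorem, Goldman–Joichi–White) Let B be a Ferrers board with c columns and height vector (h_1, …, h_c), and let n ≥ c. Then the n-factorial rook polynomial of B factors as p_n(B; x) = ∏_{i=1}^{n} (x + s_i^{(n)}), where (s_1^{(n)}, …, s_n^{(n)}) is the n-structure vector of B. -/
open Polynomial

/-- The Ferrers board with `c` columns of heights `h 1, …, h c`:
cells `{(i, j) : 1 ≤ i ≤ c, 1 ≤ j ≤ h i}`. -/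
def ferrersBoard (c : ℕ) (h : ℕ → ℕ) : Finset (ℕ × ℕ) :=
  (Finset.Icc 1 c).biUnion (fun i => ({i} : Finset ℕ) ×ˢ Finset.Icc 1 (h i))

/-- The falling factorial `(x)_i = x(x-1)⋯(x-i+1)` as a polynomial over ℤ. -/
noncomputable def fallingFactorial (i : ℕ) : Polynomial ℤ :=
  ∏ j ∈ Finset.range i, (X - C (j : ℤ))

/-- The `n`-factorial rook polynomial `p_n(B;x) = Σ_{k=0}^n r_k(B) (x)_{n-k}`. -/
noncomputable def nFactRookPoly (B : Finset (ℕ × ℕ)) (n : ℕ) : Polynomial ℤ :=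
  ∑ k ∈ Finset.range (n + 1), C ((rookNum B k : ℤ)) * fallingFactorial (n - k)

/-- The list of nonzero column heights of the Ferrers board with heights `h 1, …, h c`. -/
def nonzeroHeights (c : ℕ) (h : ℕ → ℕ) : List ℕ :=
  ((List.range c).map (fun i => h (i + 1))).filter (fun x => x != 0)

/-- The set of placements of `k` non-attacking rooks on the board `B`. -/
def rookPlacements (B : Finset (ℕ × ℕ)) (k : ℕ) : Finset (Finset (ℕ × ℕ)) :=
  B.powerset.filter (fun P => P.card = k ∧
    ∀ p ∈ P, ∀ q ∈ P, p ≠ q → p.1 ≠ q.1 ∧ p.2 ≠ q.2)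

theorem card_rookPlacements (B : Finset (ℕ × ℕ)) (k : ℕ) :
    (rookPlacements B k).card = rookNum B k := rfl

theorem mem_rookPlacements {B P : Finset (ℕ × ℕ)} {k : ℕ} :
    P ∈ rookPlacements B k ↔ P ⊆ B ∧ P.card = k ∧
      ∀ p ∈ P, ∀ q ∈ P, p ≠ q → p.1 ≠ q.1 ∧ p.2 ≠ q.2 := by
  simp [rookPlacements]

theorem card_image_fst_of_mem_rookPlacements {B P : Finset (ℕ × ℕ)} {k : ℕ}
    (hP : P ∈ rookPlacements B k) : (P.image Prod.fst).card = k := by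
  obtain ⟨-, hk, hna⟩ := mem_rookPlacements.1 hP
  rw [Finset.card_image_of_injOn, hk]
  intro p hp q hq hpq
  by_contra hne
  exact (hna p hp q hq hne).1 hpq

theorem card_image_snd_of_mem_rookPlacements {B P : Finset (ℕ × ℕ)} {k : ℕ}
    (hP : P ∈ rookPlacements B k) : (P.image Prod.snd).card = k := by
  obtain ⟨-, hk, hna⟩ := mem_rookPlacements.1 hP
  rw [Finset.card_image_of_injOn, hk]
  intro p hp q hq hpq
  by_contra hne
  exact (hna p hp q hq hne).2 hpq

theorem rookNum_zero (B : Finset (ℕ × ℕ)) : rookNum B 0 = 1 := by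
  rw [← card_rookPlacements, Finset.card_eq_one]
  refine ⟨∅, ?_⟩
  ext P
  rw [mem_rookPlacements, Finset.mem_singleton, Finset.card_eq_zero]
  constructor
  · exact fun hP => hP.2.1
  · rintro rfl
    simp

/-- There are no placements of more rooks than columns. -/
theorem rookNum_eq_zero_of_card_lt {B : Finset (ℕ × ℕ)} {T : Finset ℕ} {k : ℕ}
    (hB : ∀ p ∈ B, p.1 ∈ T) (hk : T.card < k) : rookNum B k = 0 := by
  rw [← card_rookPlacements, Finset.card_eq_zero, Finset.eq_empty_iff_forall_notMem]
  intro P hP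
  have hsub : P.image Prod.fst ⊆ T := by
    intro i hi
    obtain ⟨p, hp, rfl⟩ := Finset.mem_image.1 hi
    exact hB p ((mem_rookPlacements.1 hP).1 hp)
  have hle := Finset.card_le_card hsub
  rw [card_image_fst_of_mem_rookPlacements hP] at hle
  omega

/-- Placements on a board with an added column: either the new column is left empty,
or a rook is placed in one of the rows of the new column that are still free. -/
theorem rookPlacements_union_column {B : Finset (ℕ × ℕ)} {S : Finset ℕ} {x : ℕ}
    (hx : ∀ p ∈ B, p.1 ≠ x) (k : ℕ) :
    rookPlacements (B ∪ {x} ×ˢ S) (k + 1) = rookPlacements B (k + 1) ∪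
      ((rookPlacements B k).sigma (fun P => S \ P.image Prod.snd)).image
        (fun a => insert (x, a.2) a.1) := by
  ext Q
  simp only [Finset.mem_union, Finset.mem_image, Finset.mem_sigma, Sigma.exists,
    Finset.mem_sdiff]
  constructor
  · intro hQ
    obtain ⟨hsub, hcard, hna⟩ := mem_rookPlacements.1 hQ
    by_cases hcol : ∃ j, (x, j) ∈ Q
    · obtain ⟨j, hj⟩ := hcol
      right
      refine ⟨Q.erase (x, j), j, ⟨mem_rookPlacements.2 ⟨?_, ?_, ?_⟩, ?_, ?_⟩,
        Finset.insert_erase hj⟩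
      · intro p hp
        obtain ⟨hne, hpQ⟩ := Finset.mem_erase.1 hp
        have hpx := (hna p hpQ _ hj hne).1
        rcases Finset.mem_union.1 (hsub hpQ) with hpB | hpS
        · exact hpB
        · exact absurd (Finset.mem_singleton.1 (Finset.mem_product.1 hpS).1) hpx
      · rw [Finset.card_erase_of_mem hj, hcard, Nat.add_sub_cancel]
      · exact fun p hp q hq =>
          hna p (Finset.mem_of_mem_erase hp) q (Finset.mem_of_mem_erase hq)
      · rcases Finset.mem_union.1 (hsub hj) with hB | hS
        · exact absurd rfl (hx _ hB)
        · exact (Finset.mem_product.1 hS).2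
      · intro hmem
        obtain ⟨p, hp, hpj⟩ := hmem
        obtain ⟨hne, hpQ⟩ := Finset.mem_erase.1 hp
        exact (hna p hpQ _ hj hne).2 hpj
    · left
      refine mem_rookPlacements.2 ⟨fun p hp => ?_, hcard, hna⟩
      rcases Finset.mem_union.1 (hsub hp) with hB | hS
      · exact hB
      · refine absurd ⟨p.2, ?_⟩ hcol
        rw [← Finset.mem_singleton.1 (Finset.mem_product.1 hS).1]
        exact hp
  · rintro (hQ | ⟨P, j, ⟨hP, hjS, hjP⟩, rfl⟩)
    · obtain ⟨hsub, hcard, hna⟩ := mem_rookPlacements.1 hQ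
      exact mem_rookPlacements.2 ⟨hsub.trans Finset.subset_union_left, hcard, hna⟩
    · obtain ⟨hsub, hcard, hna⟩ := mem_rookPlacements.1 hP
      have hjne : ∀ p ∈ P, p.2 ≠ j := fun p hp hpj =>
        hjP ⟨p, hp, hpj⟩
      have hxne : ∀ p ∈ P, p.1 ≠ x := fun p hp => hx p (hsub hp)
      refine mem_rookPlacements.2 ⟨?_, ?_, ?_⟩
      · refine Finset.insert_subset ?_ (hsub.trans Finset.subset_union_left)
        simp [hjS]
      · rw [Finset.card_insert_of_notMem (fun hmem => hxne _ hmem rfl), hcard]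
      · intro p hp q hq hpq
        rcases Finset.mem_insert.1 hp with rfl | hp <;>
          rcases Finset.mem_insert.1 hq with rfl | hq
        · exact absurd rfl hpq
        · exact ⟨(hxne q hq).symm, (hjne q hq).symm⟩
        · exact ⟨hxne p hp, hjne p hp⟩
        · exact hna p hp q hq hpq

/-- Adding a column whose rows contain all rows of the board. -/
theorem rookNum_union_column {B : Finset (ℕ × ℕ)} {S : Finset ℕ} {x : ℕ}
    (hx : ∀ p ∈ B, p.1 ≠ x) (hS : ∀ p ∈ B, p.2 ∈ S) (k : ℕ) :
    (rookNum (B ∪ {x} ×ˢ S) (k + 1) : ℤ) =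
      rookNum B (k + 1) + ((S.card : ℤ) - k) * rookNum B k := by
  have hcard : ∀ P ∈ rookPlacements B k,
      ((S \ P.image Prod.snd).card : ℤ) = (S.card : ℤ) - k := by
    intro P hP
    have hsub : P.image Prod.snd ⊆ S := by
      intro i hi
      obtain ⟨p, hp, rfl⟩ := Finset.mem_image.1 hi
      exact hS p ((mem_rookPlacements.1 hP).1 hp)
    rw [Finset.cast_card_sdiff hsub, card_image_snd_of_mem_rookPlacements hP]
  rw [← card_rookPlacements, rookPlacements_union_column hx, Finset.card_union_of_disjoint,
    Finset.card_image_of_injOn, Finset.card_sigma, Nat.cast_add, Nat.cast_sum,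
    Finset.sum_congr rfl hcard, Finset.sum_const, nsmul_eq_mul, card_rookPlacements,
    card_rookPlacements, mul_comm]
  · rintro ⟨P, i⟩ hP ⟨Q, j⟩ hQ heq
    have hxP : ∀ p ∈ P, p.1 ≠ x := fun p hp =>
      hx p ((mem_rookPlacements.1 (Finset.mem_sigma.1 hP).1).1 hp)
    have hxQ : ∀ p ∈ Q, p.1 ≠ x := fun p hp =>
      hx p ((mem_rookPlacements.1 (Finset.mem_sigma.1 hQ).1).1 hp)
    replace heq : insert (x, i) P = insert (x, j) Q := heq
    have hij : i = j := by
      rcases Finset.mem_insert.1 (heq ▸ Finset.mem_insert_self (x, i) P) with hij | hmem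
      · exact congrArg Prod.snd hij
      · exact absurd rfl (hxQ _ hmem)
    subst hij
    have hPQ : P = Q := by
      rw [← Finset.erase_insert (fun hmem => hxP (x, i) hmem rfl), heq,
        Finset.erase_insert (fun hmem => hxQ (x, i) hmem rfl)]
    rw [hPQ]
  · rw [Finset.disjoint_left]
    intro Q hQ hQ'
    obtain ⟨a, -, rfl⟩ := Finset.mem_image.1 hQ'
    exact hx _ ((mem_rookPlacements.1 hQ).1 (Finset.mem_insert_self _ _)) rfl

theorem mem_ferrersBoard {c : ℕ} {h : ℕ → ℕ} {p : ℕ × ℕ} :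
    p ∈ ferrersBoard c h ↔ p.1 ∈ Finset.Icc 1 c ∧ p.2 ∈ Finset.Icc 1 (h p.1) := by
  simp only [ferrersBoard, Finset.mem_biUnion, Finset.mem_product, Finset.mem_singleton]
  constructor
  · rintro ⟨i, hi, hpi, hp⟩
    exact hpi ▸ ⟨hi, hp⟩
  · rintro ⟨hi, hp⟩
    exact ⟨p.1, hi, rfl, hp⟩

theorem ferrersBoard_succ (c : ℕ) (h : ℕ → ℕ) :
    ferrersBoard (c + 1) h =
      ferrersBoard c h ∪ {c + 1} ×ˢ Finset.Icc 1 (h (c + 1)) := by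
  rw [ferrersBoard, ← Finset.insert_Icc_right_eq_Icc_add_one (by omega),
    Finset.biUnion_insert, Finset.union_comm]
  rfl

theorem fallingFactorial_succ (i : ℕ) :
    fallingFactorial (i + 1) = fallingFactorial i * (X - C (i : ℤ)) :=
  Finset.prod_range_succ _ _

/-- If the rook numbers change as under the addition of a column of size `m`, then the
factorial rook polynomial is multiplied by `x + m - n`. -/
theorem nFactRookPoly_succ_of_rookNum {B B' : Finset (ℕ × ℕ)} {n : ℕ} {m : ℤ}
    (hB : rookNum B (n + 1) = 0)
    (hrec : ∀ k, (rookNum B' (k + 1) : ℤ) = rookNum B (k + 1) + (m - k) * rookNum B k) :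
    nFactRookPoly B' (n + 1) = nFactRookPoly B n * (X + C (m - n)) := by
  have hsplit : nFactRookPoly B' (n + 1) =
      ∑ k ∈ Finset.range (n + 2), C (rookNum B k : ℤ) * fallingFactorial (n + 1 - k) +
      ∑ k ∈ Finset.range (n + 1),
        C ((m - k) * rookNum B k : ℤ) * fallingFactorial (n - k) := by
    rw [nFactRookPoly, Finset.sum_range_succ', Finset.sum_range_succ' _ (n + 1),
      rookNum_zero, rookNum_zero, add_right_comm, ← Finset.sum_add_distrib]
    congr 1
    refine Finset.sum_congr rfl fun k _ => ?_
    rw [hrec, Nat.add_sub_add_right, C_add, add_mul]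
  rw [hsplit, Finset.sum_range_succ, hB, Nat.cast_zero, C_0, zero_mul, add_zero,
    ← Finset.sum_add_distrib, nFactRookPoly, Finset.sum_mul]
  refine Finset.sum_congr rfl fun k hk => ?_
  have hkn : k ≤ n := Nat.lt_succ_iff.1 (Finset.mem_range.1 hk)
  rw [Nat.succ_sub hkn, Nat.succ_eq_add_one, fallingFactorial_succ, Nat.cast_sub hkn]
  simp only [C_sub, C_mul]
  ring

theorem nFactRookPoly_ferrersBoard_zero (h : ℕ → ℕ) (n : ℕ) :
    nFactRookPoly (ferrersBoard 0 h) n = fallingFactorial n := by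
  have hzero : ∀ k, 0 < k → rookNum (ferrersBoard 0 h) k = 0 := fun k hk =>
    rookNum_eq_zero_of_card_lt (T := Finset.Icc 1 0) (fun p hp => (mem_ferrersBoard.1 hp).1)
      (by simpa using hk)
  rw [nFactRookPoly, Finset.sum_eq_single 0]
  · simp [rookNum_zero]
  · intro k _ hk
    simp [hzero k (Nat.pos_of_ne_zero hk)]
  · simp

theorem nFactRookPoly_ferrersBoard_succ {c : ℕ} {h : ℕ → ℕ}
    (hmono : ∀ i j, 1 ≤ i → i ≤ j → j ≤ c + 1 → h i ≤ h j) {n : ℕ} (hn : c ≤ n) :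
    nFactRookPoly (ferrersBoard (c + 1) h) (n + 1) =
      nFactRookPoly (ferrersBoard c h) n * (X + C ((h (c + 1) : ℤ) - n)) := by
  refine nFactRookPoly_succ_of_rookNum ?_ fun k => ?_
  · exact rookNum_eq_zero_of_card_lt (T := Finset.Icc 1 c)
      (fun p hp => (mem_ferrersBoard.1 hp).1) (by rw [Nat.card_Icc]; omega)
  · rw [ferrersBoard_succ, rookNum_union_column, Nat.card_Icc, Nat.add_sub_cancel]
    · intro p hp
      have := Finset.mem_Icc.1 (mem_ferrersBoard.1 hp).1
      omega
    · intro p hp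
      obtain ⟨hp1, hp2⟩ := mem_ferrersBoard.1 hp
      rw [Finset.mem_Icc] at hp1 hp2 ⊢
      exact ⟨hp2.1, hp2.2.trans (hmono _ _ hp1.1 (by omega) le_rfl)⟩

/-- **Factorization Theorem (Goldman–Joichi–White).**
For a Ferrers board `B` with `c` columns of (nondecreasing) heights `h 1 ≤ … ≤ h c`
and any `n ≥ c`, the `n`-factorial rook polynomial factors as
`p_n(B;x) = ∏_{i=1}^n (x + s_i^{(n)})`, where `s_i^{(n)} = h_i^{(n)} - (i-1)`
and `h_i^{(n)}` is the `n`-height vector (the heights padded with `n - c` zeros on the left). -/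
theorem factorization_theorem (c : ℕ) (h : ℕ → ℕ)
    (hmono : ∀ i j, 1 ≤ i → i ≤ j → j ≤ c → h i ≤ h j)
    (n : ℕ) (hn : c ≤ n) :
    nFactRookPoly (ferrersBoard c h) n =
      ∏ i ∈ Finset.Icc 1 n,
        (X + C ((if i ≤ n - c then (0 : ℤ) else (h (i - (n - c)) : ℤ)) - ((i : ℤ) - 1))) := by
  obtain ⟨d, rfl⟩ := Nat.exists_eq_add_of_le hn
  clear hn
  rw [Nat.add_sub_cancel_left]
  induction c with
  | zero =>
    rw [nFactRookPoly_ferrersBoard_zero, zero_add, fallingFactorial, Finset.range_eq_Ico,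
      ← Finset.prod_Ico_add_right_sub_eq 0 d 1]
    refine Finset.prod_congr (by ext; simp) fun i hi => ?_
    have hi' := Finset.mem_Icc.1 hi
    rw [if_pos hi'.2, Nat.cast_sub hi'.1]
    simp [sub_eq_add_neg]
  | succ c ih =>
    rw [Nat.add_right_comm, nFactRookPoly_ferrersBoard_succ hmono (Nat.le_add_right c d),
      ih (fun i j hi hij hj => hmono i j hi hij (by omega)),
      Finset.prod_Icc_succ_top (by omega), if_neg (by omega),
      show c + d + 1 - d = c + 1 by omega, Nat.cast_add_one, add_sub_cancel_right]
end

section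
/- Let q(x) = Σ_{k=0}^{m} q_k x^k be a polynomial over ℤ which is the rook polynomial of an increasing Ferrers board B (i.e. q_k = r_k(B) for all k). Let n = ⌊√(2 q_1)⌋ and let p(x) = Σ_{k=0}^{m} q_k (x)_{n−k} be the associated n-factorial polynomial. Then p(x) factors over ℤ into linear factors with integer roots, and (x)_{t+1} divides p(x), where t is the largest root of p(x). -/
open Polynomial

theorem mem_ferrersBoard_s7 {c : ℕ} {h : ℕ → ℕ} {x : ℕ × ℕ} :
    x ∈ ferrersBoard c h ↔ (1 ≤ x.1 ∧ x.1 ≤ c) ∧ 1 ≤ x.2 ∧ x.2 ≤ h x.1 := by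
  obtain ⟨i, j⟩ := x
  simp only [ferrersBoard, Finset.mem_biUnion, Finset.mem_product, Finset.mem_singleton,
    Finset.mem_Icc]
  constructor
  · rintro ⟨a, ha, rfl, hj⟩
    exact ⟨ha, hj⟩
  · rintro ⟨ha, hj⟩
    exact ⟨i, ha, rfl, hj⟩

theorem rookNum_empty_succ (k : ℕ) : rookNum ∅ (k + 1) = 0 := by
  rw [← card_rookPlacements, Finset.card_eq_zero, Finset.eq_empty_iff_forall_notMem]
  intro P hP
  obtain ⟨h, hc, -⟩ := mem_rookPlacements.mp hP
  rw [Finset.subset_empty.mp h] at hc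
  simp at hc

theorem ferrersBoard_eq_empty {a : ℕ} {h : ℕ → ℕ} (ha : ∀ i, 1 ≤ i → i ≤ a → h i = 0) :
    ferrersBoard a h = ∅ := by
  rw [Finset.eq_empty_iff_forall_notMem]
  intro x hx
  have hx' := mem_ferrersBoard_s7.mp hx
  have := ha x.1 hx'.1.1 hx'.1.2
  omega

/-- The rows of an `H`-row column that are not attacked by the placement `P`. -/
def freeRows (H : ℕ) (P : Finset (ℕ × ℕ)) : Finset ℕ := Finset.Icc 1 H \ P.image Prod.snd

theorem mem_freeRows {H j : ℕ} {P : Finset (ℕ × ℕ)} :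
    j ∈ freeRows H P ↔ (1 ≤ j ∧ j ≤ H) ∧ ∀ p ∈ P, p.2 ≠ j := by
  simp only [freeRows, Finset.mem_sdiff, Finset.mem_Icc, Finset.mem_image, not_exists, not_and,
    ne_eq]

theorem card_freeRows {c k : ℕ} {h : ℕ → ℕ} (hle : ∀ i, 1 ≤ i → i ≤ c → h i ≤ h (c + 1))
    {P : Finset (ℕ × ℕ)} (hP : P ∈ rookPlacements (ferrersBoard c h) k) :
    ((freeRows (h (c + 1)) P).card : ℤ) = h (c + 1) - k := by
  obtain ⟨hB, hk, hna⟩ := mem_rookPlacements.mp hP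
  have hsub : P.image Prod.snd ⊆ Finset.Icc 1 (h (c + 1)) := by
    intro j hj
    obtain ⟨x, hx, rfl⟩ := Finset.mem_image.mp hj
    have hx' := mem_ferrersBoard_s7.mp (hB hx)
    have := hle x.1 hx'.1.1 hx'.1.2
    exact Finset.mem_Icc.mpr ⟨hx'.2.1, hx'.2.2.trans this⟩
  have hcard : (P.image Prod.snd).card = k := by
    rw [Finset.card_image_of_injOn, hk]
    intro x hx y hy hxy
    by_contra hne
    exact (hna x hx y hy hne).2 hxy
  have h1 := Finset.card_le_card hsub
  have h2 := Finset.card_sdiff_of_subset hsub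
  rw [hcard, Nat.card_Icc] at h1 h2
  rw [freeRows, h2]
  omega

theorem filter_rookPlacements_last_column_unused (c k : ℕ) (h : ℕ → ℕ) :
    (rookPlacements (ferrersBoard (c + 1) h) k).filter (fun P => ∀ x ∈ P, x.1 ≠ c + 1) =
      rookPlacements (ferrersBoard c h) k := by
  ext P
  rw [Finset.mem_filter, mem_rookPlacements, mem_rookPlacements]
  constructor
  · rintro ⟨⟨hB, hk⟩, hc⟩
    refine ⟨fun x hx => ?_, hk⟩
    have h1 := mem_ferrersBoard_s7.mp (hB hx)
    have h2 := hc x hx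
    exact mem_ferrersBoard_s7.mpr ⟨by omega, h1.2⟩
  · rintro ⟨hB, hk⟩
    refine ⟨⟨fun x hx => ?_, hk⟩, fun x hx => ?_⟩
    · have h1 := mem_ferrersBoard_s7.mp (hB hx)
      exact mem_ferrersBoard_s7.mpr ⟨by omega, h1.2⟩
    · have h1 := mem_ferrersBoard_s7.mp (hB hx)
      omega

theorem card_filter_rookPlacements_last_column_used (c k : ℕ) (h : ℕ → ℕ) :
    ((rookPlacements (ferrersBoard (c + 1) h) (k + 1)).filter
        (fun P => ¬ ∀ x ∈ P, x.1 ≠ c + 1)).card =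
      ∑ P ∈ rookPlacements (ferrersBoard c h) k, (freeRows (h (c + 1)) P).card := by
  rw [← Finset.card_sigma]
  symm
  refine Finset.card_bij (fun s _ => insert (c + 1, s.2) s.1) ?_ ?_ ?_
  · rintro ⟨P, j⟩ hs
    obtain ⟨hP, hj⟩ := Finset.mem_sigma.mp hs
    obtain ⟨hB, hk, hna⟩ := mem_rookPlacements.mp hP
    obtain ⟨hj, hfree⟩ := mem_freeRows.mp hj
    have hcol : ∀ x ∈ P, x.1 ≤ c := fun x hx => (mem_ferrersBoard_s7.mp (hB hx)).1.2
    have hnot : (c + 1, j) ∉ P := fun hx => by simpa using hcol _ hx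
    refine Finset.mem_filter.mpr ⟨mem_rookPlacements.mpr ⟨?_, ?_, ?_⟩, ?_⟩
    · intro x hx
      rcases Finset.mem_insert.mp hx with rfl | hx
      · exact mem_ferrersBoard_s7.mpr ⟨by simp, hj⟩
      · have h1 := mem_ferrersBoard_s7.mp (hB hx)
        exact mem_ferrersBoard_s7.mpr ⟨by omega, h1.2⟩
    · rw [Finset.card_insert_of_notMem hnot, hk]
    · intro x hx y hy hxy
      rcases Finset.mem_insert.mp hx with rfl | hx <;> rcases Finset.mem_insert.mp hy with rfl | hy
      · exact absurd rfl hxy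
      · exact ⟨by have := hcol y hy; dsimp only; omega, (hfree y hy).symm⟩
      · exact ⟨by have := hcol x hx; dsimp only; omega, hfree x hx⟩
      · exact hna x hx y hy hxy
    · intro hall
      exact hall _ (Finset.mem_insert_self _ _) rfl
  · rintro ⟨P, j⟩ hs ⟨P', j'⟩ hs' heq
    have hcol : ∀ {P : Finset (ℕ × ℕ)} {j : ℕ},
        (⟨P, j⟩ : Σ _ : Finset (ℕ × ℕ), ℕ) ∈ (rookPlacements (ferrersBoard c h) k).sigma
          (fun P => freeRows (h (c + 1)) P) → ∀ i, (c + 1, i) ∉ P := by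
      intro P j hs i hi
      have := (mem_ferrersBoard_s7.mp ((mem_rookPlacements.mp (Finset.mem_sigma.mp hs).1).1 hi)).1.2
      simp at this
    dsimp only at heq
    have hj : j = j' := by
      have hmem : (c + 1, j) ∈ insert (c + 1, j') P' := heq ▸ Finset.mem_insert_self _ _
      rcases Finset.mem_insert.mp hmem with hm | hm
      · exact (Prod.mk.inj hm).2
      · exact absurd hm (hcol hs' _)
    subst hj
    have hPP : P = P' := by
      rw [← Finset.erase_insert (hcol hs j), heq, Finset.erase_insert (hcol hs' j)]
    rw [hPP]
  · intro Q hQ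
    obtain ⟨hQ, hused⟩ := Finset.mem_filter.mp hQ
    obtain ⟨hB, hk, hna⟩ := mem_rookPlacements.mp hQ
    push Not at hused
    obtain ⟨⟨i, j⟩, hx, hi⟩ := hused
    dsimp only at hi
    subst hi
    refine ⟨⟨Q.erase (c + 1, j), j⟩, Finset.mem_sigma.mpr
      ⟨mem_rookPlacements.mpr ⟨?_, ?_, ?_⟩, mem_freeRows.mpr ⟨?_, ?_⟩⟩, Finset.insert_erase hx⟩
    · intro y hy
      obtain ⟨hne, hy⟩ := Finset.mem_erase.mp hy
      have h1 := mem_ferrersBoard_s7.mp (hB hy)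
      have h2 := (hna y hy _ hx hne).1
      dsimp only at h2
      exact mem_ferrersBoard_s7.mpr ⟨by omega, h1.2⟩
    · rw [Finset.card_erase_of_mem hx, hk, Nat.add_sub_cancel]
    · intro y hy z hz
      exact hna y (Finset.mem_of_mem_erase hy) z (Finset.mem_of_mem_erase hz)
    · exact (mem_ferrersBoard_s7.mp (hB hx)).2
    · intro y hy
      obtain ⟨hne, hy⟩ := Finset.mem_erase.mp hy
      exact (hna y hy _ hx hne).2

/-- Adding a highest column to a Ferrers board: either it stays empty, or it carries one of the
rooks, in a row left free by the others. -/
theorem rookNum_ferrersBoard_succ {c : ℕ} {h : ℕ → ℕ}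
    (hle : ∀ i, 1 ≤ i → i ≤ c → h i ≤ h (c + 1)) (k : ℕ) :
    (rookNum (ferrersBoard (c + 1) h) (k + 1) : ℤ) =
      rookNum (ferrersBoard c h) (k + 1) + (h (c + 1) - k) * rookNum (ferrersBoard c h) k := by
  rw [← card_rookPlacements, ← Finset.card_filter_add_card_filter_not
    (fun P : Finset (ℕ × ℕ) => ∀ x ∈ P, x.1 ≠ c + 1), filter_rookPlacements_last_column_unused,
    card_filter_rookPlacements_last_column_used, Nat.cast_add, Nat.cast_sum,
    Finset.sum_congr rfl (fun P hP => card_freeRows hle hP), Finset.sum_const,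
    card_rookPlacements, card_rookPlacements, nsmul_eq_mul, mul_comm]

section Padded

variable {a d : ℕ} {h : ℕ → ℕ}

theorem rookNum_eq_zero_of_lt (ha : ∀ i, 1 ≤ i → i ≤ a → h i = 0)
    (hmono : ∀ i j, 1 ≤ i → i ≤ j → j ≤ a + d → h i ≤ h j) {k : ℕ} (hk : d < k) :
    rookNum (ferrersBoard (a + d) h) k = 0 := by
  induction d generalizing k with
  | zero =>
    obtain ⟨k, rfl⟩ := Nat.exists_eq_succ_of_ne_zero hk.ne'
    rw [add_zero, ferrersBoard_eq_empty ha]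
    exact rookNum_empty_succ k
  | succ d ih =>
    obtain ⟨k, rfl⟩ := Nat.exists_eq_succ_of_ne_zero (Nat.ne_of_gt (Nat.zero_lt_of_lt hk))
    have hrec := rookNum_ferrersBoard_succ (c := a + d) (h := h)
      (fun i hi hi' => hmono i _ hi (by omega) (by omega)) k
    have hmono' : ∀ i j, 1 ≤ i → i ≤ j → j ≤ a + d → h i ≤ h j :=
      fun i j h1 h2 h3 => hmono i j h1 h2 (by omega)
    rw [ih hmono' (by omega), ih hmono' (by omega)] at hrec
    simpa [← add_assoc] using hrec

theorem mul_succ_le_two_mul_rookNum_one (hmono : ∀ i j, 1 ≤ i → i ≤ j → j ≤ a + d → h i ≤ h j)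
    (hge : ∀ j, j < d → j + 1 ≤ h (a + j + 1)) :
    d * (d + 1) ≤ 2 * rookNum (ferrersBoard (a + d) h) 1 := by
  induction d with
  | zero => simp
  | succ d ih =>
    have hrec := rookNum_ferrersBoard_succ (c := a + d) (h := h)
      (fun i hi hi' => hmono i _ hi (by omega) (by omega)) 0
    rw [rookNum_zero] at hrec
    have h1 := ih (fun i j h1 h2 h3 => hmono i j h1 h2 (by omega)) (fun j hj => hge j (by omega))
    have h2 := hge d (by omega)
    have h3 : rookNum (ferrersBoard (a + (d + 1)) h) 1 =
        rookNum (ferrersBoard (a + d) h) 1 + h (a + d + 1) := by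
      zify
      simpa [← add_assoc] using hrec
    rw [h3]
    nlinarith

/-- The Goldman–Joichi–White factorization for a Ferrers board whose first `a` columns are
empty. -/
theorem sum_rookNum_mul_fallingFactorial (ha : ∀ i, 1 ≤ i → i ≤ a → h i = 0)
    (hmono : ∀ i j, 1 ≤ i → i ≤ j → j ≤ a + d → h i ≤ h j) (N : ℕ) :
    ∑ k ∈ Finset.range (d + 1),
        C (rookNum (ferrersBoard (a + d) h) k : ℤ) * fallingFactorial (N + d - k) =
      fallingFactorial N * ∏ j ∈ Finset.range d, (X - C ((N : ℤ) + j - h (a + j + 1))) := by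
  induction d with
  | zero => simp [rookNum_zero]
  | succ d ih =>
    have hmono' : ∀ i j, 1 ≤ i → i ≤ j → j ≤ a + d → h i ≤ h j :=
      fun i j h1 h2 h3 => hmono i j h1 h2 (by omega)
    have hrec := rookNum_ferrersBoard_succ (c := a + d) (h := h)
      (fun i hi hi' => hmono i _ hi (by omega) (by omega))
    rw [Finset.prod_range_succ, ← mul_assoc, ← ih hmono', Finset.sum_range_succ',
      Finset.sum_mul]
    simp only [← add_assoc] at hrec ⊢
    simp only [hrec, C_add, add_mul, Finset.sum_add_distrib, rookNum_zero]
    have hshift : ∑ k ∈ Finset.range (d + 1), C (rookNum (ferrersBoard (a + d) h) (k + 1) : ℤ) *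
          fallingFactorial (N + d + 1 - (k + 1)) + C (rookNum (ferrersBoard (a + d) h) 0 : ℤ) *
          fallingFactorial (N + d + 1 - 0) =
        ∑ k ∈ Finset.range (d + 1), C (rookNum (ferrersBoard (a + d) h) k : ℤ) *
          fallingFactorial (N + d + 1 - k) := by
      rw [← Finset.sum_range_succ' (fun k => C (rookNum (ferrersBoard (a + d) h) k : ℤ) *
          fallingFactorial (N + d + 1 - k)), Finset.sum_range_succ,
        rookNum_eq_zero_of_lt ha hmono' (Nat.lt_succ_self d)]
      simp
    rw [rookNum_zero] at hshift
    rw [add_right_comm, hshift, ← Finset.sum_add_distrib]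
    refine Finset.sum_congr rfl fun k hk => ?_
    have hk : k ≤ d := by simpa [Nat.lt_succ_iff] using hk
    have e1 : N + d + 1 - k = (N + d - k) + 1 := by omega
    have e2 : N + d + 1 - (k + 1) = N + d - k := by omega
    have e3 : ((N + d - k : ℕ) : ℤ) = N + d - k := by
      rw [Nat.cast_sub (by omega), Nat.cast_add]
    rw [e1, e2, fallingFactorial_succ, e3]
    simp only [C_sub, C_add, C_mul]
    ring

end Padded

/-- If `q(x) = Σ_{k=0}^m q_k x^k ∈ ℤ[x]` is the rook polynomial of an increasing Ferrers
board, `n = ⌊√(2 q_1)⌋`, and `p(x) = Σ_{k=0}^m q_k (x)_{n-k}` is the associated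
`n`-factorial polynomial, then `p` factors over ℤ into linear factors with integer roots,
and `(x)_{t+1} ∣ p(x)` where `t` is the largest root of `p`. -/
theorem rook_poly_necessary_conditions (q : Polynomial ℤ) (c : ℕ) (hcol : ℕ → ℕ)
    (hinc : ∀ i j, 1 ≤ i → i < j → j ≤ c → hcol i < hcol j)
    (hq : ∀ k, q.coeff k = (rookNum (ferrersBoard c hcol) k : ℤ))
    (n : ℕ) (hn : n = Nat.sqrt (2 * (q.coeff 1).toNat))
    (p : Polynomial ℤ)
    (hp : p = ∑ k ∈ Finset.range (q.natDegree + 1), C (q.coeff k) * fallingFactorial (n - k)) :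
    (∃ s : Multiset ℤ, p = (s.map (fun a => X - C a)).prod) ∧
    ∀ t : ℤ, IsGreatest {r : ℤ | p.IsRoot r} t → fallingFactorial (t + 1).toNat ∣ p := by
  obtain ⟨a, d, rfl, ha, hge⟩ : ∃ a d, c = a + d ∧ (∀ i, 1 ≤ i → i ≤ a → hcol i = 0) ∧
      ∀ j, j < d → j + 1 ≤ hcol (a + j + 1) := by
    by_cases h0 : 1 ≤ c ∧ hcol 1 = 0
    · refine ⟨1, c - 1, by omega, fun i h1 h2 => ?_, fun j => ?_⟩
      · rw [le_antisymm h2 h1, h0.2]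
      · induction j with
        | zero =>
          intro hj
          have := hinc 1 2 le_rfl (by omega) (by omega)
          exact Nat.one_le_of_lt this
        | succ j ih =>
          intro hj
          have h1 := ih (by omega)
          have h2 := hinc (1 + j + 1) (1 + (j + 1) + 1) (by omega) (by omega) (by omega)
          omega
    · refine ⟨0, c, by omega, fun i h1 h2 => by omega, fun j => ?_⟩
      induction j with
      | zero =>
        intro hj
        simp only [zero_add]
        by_contra hcon
        exact h0 ⟨hj, by omega⟩
      | succ j ih =>
        intro hj
        have h1 := ih (by omega)
        have h2 := hinc (0 + j + 1) (0 + (j + 1) + 1) (by omega) (by omega) (by omega)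
        omega
  have hmono : ∀ i j, 1 ≤ i → i ≤ j → j ≤ a + d → hcol i ≤ hcol j := by
    intro i j h1 h2 h3
    rcases h2.eq_or_lt with rfl | h2
    · exact le_rfl
    · exact (hinc i j h1 h2 h3).le
  have hdn : d ≤ n := by
    rw [hn, hq, Int.toNat_natCast, Nat.le_sqrt]
    have := mul_succ_le_two_mul_rookNum_one hmono hge
    nlinarith
  obtain ⟨N, rfl⟩ := Nat.exists_eq_add_of_le' hdn
  have hdeg : q.natDegree ≤ d := by
    rw [natDegree_le_iff_coeff_eq_zero]
    intro k hk
    rw [hq, rookNum_eq_zero_of_lt ha hmono hk, Nat.cast_zero]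
  have hfac : p = fallingFactorial N *
      ∏ j ∈ Finset.range d, (X - C ((N : ℤ) + j - hcol (a + j + 1))) := by
    rw [hp, ← sum_rookNum_mul_fallingFactorial ha hmono N]
    simp only [← hq]
    refine Finset.sum_subset (Finset.range_subset_range.mpr (by omega)) fun k _ hk => ?_
    rw [coeff_eq_zero_of_natDegree_lt (by simpa [Nat.lt_succ_iff] using hk), C_0, zero_mul]
  refine ⟨⟨(Finset.range N).val.map (fun j : ℕ => (j : ℤ)) +
    (Finset.range d).val.map (fun j : ℕ => (N : ℤ) + j - hcol (a + j + 1)), ?_⟩, ?_⟩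
  · rw [hfac, Multiset.map_add, Multiset.prod_add, Multiset.map_map, Multiset.map_map]
    rfl
  · intro t ht
    have hroot : p.IsRoot t := ht.1
    have htN : (t + 1).toNat ≤ N := by
      rw [hfac, IsRoot.def, eval_mul, fallingFactorial, eval_prod, eval_prod, mul_eq_zero,
        Finset.prod_eq_zero_iff, Finset.prod_eq_zero_iff] at hroot
      simp only [Finset.mem_range, eval_sub, eval_X, eval_C] at hroot
      rcases hroot with ⟨j, hj, hj'⟩ | ⟨j, hj, hj'⟩
      · omega
      · have := hge j hj
        omega
    rw [hfac]
    exact Dvd.dvd.mul_right (Finset.prod_dvd_prod_of_subset _ _ _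
      (Finset.range_subset_range.mpr htN)) _
end
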